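/- arXiv:1607.07629 — 2 statements merged into one kernel-verified Lean document; each statement's English description precedes it below -/
import Mathlib

section
/- Let (R, m) be a Noetherian local ring, N a finitely generated R-module, and p ∈ Supp(N) with dim R/p = 1. If the p-symbolic topology on N is equivalent to the p-adic topology on N, then for every z ∈ Ass_{R*}(N*) there exists q ∈ Supp(N*) such that z ⊆ q and q ∩ R = p, where R* and N* denote the m-adic completions of R and N. -/
open Ideal

/-- The set of minimal associated primes of an `R`-module `M`. -/
def mAss (R : Type*) [CommRing R] (M : Type*) [AddCommGroup M] [Module R M] : Set (Ideal R) :=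
  {p | Minimal (· ∈ associatedPrimes R M) p}

/-- The `n`-th symbolic power of `I` with respect to `N`:
elements `x ∈ N` with `s • x ∈ I ^ n • N` for some `s` outside every minimal prime of
`Ass_R (N / I N)`. -/
def symbPow (R : Type*) [CommRing R] (I : Ideal R) (N : Type*) [AddCommGroup N] [Module R N]
    (n : ℕ) : Set N :=
  {x | ∃ s : R, (∀ p ∈ mAss R (N ⧸ (I • ⊤ : Submodule R N)), s ∉ p) ∧
    s • x ∈ (I ^ n • ⊤ : Submodule R N)}

/-- The `I`-symbolic topology on `N` is equivalent to the `I`-adic topology on `N`. -/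
def symbEquivAdic (R : Type*) [CommRing R] (I : Ideal R) (N : Type*) [AddCommGroup N]
    [Module R N] : Prop :=
  ∀ n : ℕ, ∃ m : ℕ, symbPow R I N m ⊆ (I ^ n • ⊤ : Submodule R N)

theorem aux_AR {R : Type*} [CommRing R] [IsNoetherianRing R] {N : Type*} [AddCommGroup N]
    [Module R N] [Module.Finite R N] (I : Ideal R) (K : Submodule R N) (s : R) :
    ∃ c : ℕ, ∀ j ≥ c, ∀ y : N, s • y ∈ K ⊔ I ^ j • (⊤ : Submodule R N) →
      ∃ w ∈ I ^ (j - c) • (⊤ : Submodule R N), s • (y - w) ∈ K := by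
  obtain ⟨c, hc⟩ := I.exists_pow_inf_eq_pow_smul
    (LinearMap.range (LinearMap.lsmul R (N ⧸ K) s))
  refine ⟨c, fun j hj y hy => ?_⟩
  have h1 : K.mkQ (s • y) ∈ I ^ j • (⊤ : Submodule R (N ⧸ K)) := by
    have h := Submodule.mem_map_of_mem (f := K.mkQ) hy
    rw [Submodule.map_sup, Submodule.map_smul'', Submodule.map_top, Submodule.range_mkQ] at h
    simpa using h
  have h2 : K.mkQ (s • y) ∈ LinearMap.range (LinearMap.lsmul R (N ⧸ K) s) :=
    ⟨K.mkQ y, by simp⟩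
  have h3 : K.mkQ (s • y) ∈ I ^ (j - c) • LinearMap.range (LinearMap.lsmul R (N ⧸ K) s) := by
    have h : K.mkQ (s • y) ∈ I ^ j • (⊤ : Submodule R (N ⧸ K)) ⊓
      LinearMap.range (LinearMap.lsmul R (N ⧸ K) s) := ⟨h1, h2⟩
    rw [hc j hj] at h
    exact Submodule.smul_mono le_rfl inf_le_right h
  rw [LinearMap.range_eq_map, ← Submodule.map_smul'', ← Submodule.range_mkQ K,
    LinearMap.range_eq_map, ← Submodule.map_smul''] at h3
  obtain ⟨_, ⟨w, hw, rfl⟩, h4⟩ := h3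
  refine ⟨w, hw, ?_⟩
  rw [← Submodule.Quotient.mk_eq_zero, smul_sub]
  simp only [LinearMap.lsmul_apply, Submodule.mkQ_apply] at h4
  simp only [Submodule.Quotient.mk_sub, Submodule.Quotient.mk_smul] at h4 ⊢
  rw [h4, sub_self]

theorem aux_symb {R : Type*} [CommRing R] [IsNoetherianRing R] {N : Type*} [AddCommGroup N]
    [Module R N] [Module.Finite R N] (p : Ideal R) (hp : p.IsPrime)
    (hpsupp : Module.annihilator R N ≤ p) (n : ℕ) (x : N) (s : R) (hs : s ∉ p)
    (h : s • x ∈ (p ^ n • ⊤ : Submodule R N)) : x ∈ symbPow R p N n := by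
  refine ⟨s, fun P hP hsP => hs ?_, h⟩
  have hpP : p ≤ Module.annihilator R (N ⧸ (p • ⊤ : Submodule R N)) := by
    intro a ha
    rw [Module.mem_annihilator]
    intro y
    obtain ⟨y, rfl⟩ := Submodule.mkQ_surjective _ y
    rw [← map_smul, Submodule.mkQ_apply, Submodule.Quotient.mk_eq_zero]
    exact Submodule.smul_mem_smul ha trivial
  have hle : Module.annihilator R (N ⧸ (p • ⊤ : Submodule R N)) ≤ p := by
    have : (⟨p, hp⟩ : PrimeSpectrum R) ∈ Module.support R (N ⧸ (p • ⊤ : Submodule R N)) := by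
      rw [Module.support_quotient]
      exact ⟨Module.mem_support_iff_of_finite.mpr hpsupp, le_refl p⟩
    exact Module.mem_support_iff_of_finite.mp this
  have hpA : p ∈ associatedPrimes R (N ⧸ (p • ⊤ : Submodule R N)) := by
    apply Module.associatedPrimes.minimalPrimes_annihilator_subset_associatedPrimes
    exact ⟨⟨hp, hle⟩, fun q hq _ => hpP.trans hq.2⟩
  have hPann : Module.annihilator R (N ⧸ (p • ⊤ : Submodule R N)) ≤ P := by
    rw [← Submodule.annihilator_top]
    exact IsAssociatedPrime.annihilator_le hP.1
  exact hP.2 hpA (hpP.trans hPann) hsP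

theorem aux_smul {R S M : Type*} [CommRing R] [CommRing S] [Algebra R S] [AddCommGroup M]
    [Module R M] [Module S M] [IsScalarTower R S M] (I : Ideal R) (g : S)
    (hg : g ∈ I.map (algebraMap R S)) (x : M) : g • x ∈ (I • ⊤ : Submodule R M) := by
  induction hg using Submodule.span_induction generalizing x with
  | mem y hy =>
    obtain ⟨r, hr, rfl⟩ := hy
    rw [algebraMap_smul]
    exact Submodule.smul_mem_smul hr trivial
  | zero => simp
  | add a b _ _ ha hb => rw [add_smul]; exact add_mem (ha x) (hb x)
  | smul a b _ hb =>
    rw [smul_eq_mul, mul_comm, mul_smul]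
    exact hb _

theorem aux_max {R : Type*} [CommRing R] [IsLocalRing R] (p : Ideal R) (hp : p.IsPrime)
    (hdim : ringKrullDim (R ⧸ p) = 1) (Q : Ideal R) (hqc : Q.IsPrime) (hpq : p ≤ Q)
    (hne : Q ≠ p) : Q = IsLocalRing.maximalIdeal R := by
  have : Ring.KrullDimLE 1 (R ⧸ p) := Ring.krullDimLE_iff.mpr (by simp [hdim])
  have hdom : IsDomain (R ⧸ p) := Ideal.Quotient.isDomain p
  have hpr : (Q.map (Ideal.Quotient.mk p)).IsPrime :=
    Ideal.map_isPrime_of_surjective Ideal.Quotient.mk_surjective (by simpa using hpq)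
  have hmx := Ideal.IsPrime.isMaximal_of_ne_bot hpr (by
    intro h0
    apply hne
    refine le_antisymm ?_ hpq
    rwa [Ideal.map_eq_bot_iff_le_ker, Ideal.mk_ker] at h0)
  have h2 := Ideal.comap_isMaximal_of_surjective (Ideal.Quotient.mk p)
    Ideal.Quotient.mk_surjective (K := Q.map (Ideal.Quotient.mk p))
  rw [Ideal.comap_map_of_surjective' _ Ideal.Quotient.mk_surjective, Ideal.mk_ker,
    sup_eq_left.mpr hpq] at h2
  exact IsLocalRing.eq_maximalIdeal h2

open IsLocalRing in
theorem aux_pow {R S M : Type*} [CommRing R] [IsNoetherianRing R] [IsLocalRing R] [CommRing S]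
    [Algebra R S] [AddCommGroup M] [Module R M] [Module S M] [IsScalarTower R S M]
    (p : Ideal R) (hp : p.IsPrime) (hdim : ringKrullDim (R ⧸ p) = 1) (z : Ideal S) (x : M)
    (hx : z = ((⊥ : Submodule S M).colon {x}).radical)
    (hcon : ∀ q : Ideal S, q.IsPrime → Module.annihilator S M ≤ q → z ≤ q →
      q.comap (algebraMap R S) ≠ p) :
    ∃ u : R, u ∉ p ∧ ∀ n : ℕ, u ^ n • x ∈ (p ^ n • ⊤ : Submodule R M) := by
  set f := algebraMap R S with hf
  set a : Ideal S := (⊥ : Submodule S M).colon {x} with ha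
  have hxa : ∀ α ∈ a, α • x = 0 := by
    intro α hα
    simpa [ha, Submodule.mem_colon_singleton] using hα
  have hm : maximalIdeal R ≤ ((a ⊔ p.map f).comap f).radical := by
    rw [← Ideal.comap_radical, Ideal.radical_eq_sInf]
    intro r hr
    rw [Ideal.mem_comap, Submodule.mem_sInf]
    rintro (q : Ideal S) ⟨hq, hqp⟩
    have hqp : q.IsPrime := hqp
    have hq : a ⊔ p.map f ≤ q := hq
    have hpq0 : p.map f ≤ q := le_trans le_sup_right hq
    have haq : a ≤ q := le_trans le_sup_left hq
    have hpq : p ≤ q.comap f := Ideal.map_le_iff_le_comap.mp hpq0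
    have hzq : z ≤ q := by
      rw [hx]; exact hqp.isRadical.radical_le_iff.mpr haq
    have hne := hcon q hqp (le_trans (fun b hb => by
      rw [ha, Submodule.mem_colon_singleton]
      simpa using Module.mem_annihilator.mp hb x) haq) hzq
    have hqc : (q.comap f).IsPrime := Ideal.comap_isPrime f q
    have hmax := aux_max p hp hdim _ hqc hpq hne
    have : r ∈ q.comap f := hmax ▸ hr
    exact this
  obtain ⟨k, hk⟩ := Ideal.exists_pow_le_of_le_radical_of_fg hm (IsNoetherian.noetherian _)
  obtain ⟨t, htm, htp⟩ : ∃ t ∈ maximalIdeal R, t ∉ p := by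
    by_contra! h
    have hpm : p = maximalIdeal R := le_antisymm (IsLocalRing.le_maximalIdeal hp.ne_top) h
    have : p.IsMaximal := hpm ▸ inferInstance
    letI := Ideal.Quotient.field p
    rw [ringKrullDim_eq_zero_of_field] at hdim
    exact zero_ne_one hdim
  obtain ⟨α, hα, β, hβ, hab⟩ := Submodule.mem_sup.mp (hk (Ideal.pow_mem_pow htm k))
  have hpow : ∀ n : ℕ, ((t ^ k) ^ n) • x = β ^ n • x := by
    intro n
    rw [← algebraMap_smul S, map_pow]
    change (f (t ^ k)) ^ n • x = _
    rw [← hab]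
    induction n with
    | zero => simp
    | succ n ih =>
      rw [pow_succ, mul_smul, add_smul, hxa α hα, zero_add, smul_comm, ih, smul_smul, pow_succ']
  refine ⟨t ^ k, fun h => htp (hp.mem_of_pow_mem _ h), fun n => ?_⟩
  rw [hpow n]
  apply aux_smul
  rw [Ideal.map_pow]
  exact Ideal.pow_mem_pow hβ n

open IsLocalRing in
theorem stmt8 (R : Type*) [CommRing R] [IsNoetherianRing R] [IsLocalRing R]
    (N : Type*) [AddCommGroup N] [Module R N] [Module.Finite R N] [Nontrivial N]
    (p : Ideal R) (hp : p.IsPrime) (hpsupp : Module.annihilator R N ≤ p)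
    (hdim : ringKrullDim (R ⧸ p) = 1)
    (heq : symbEquivAdic R p N) :
    ∀ z ∈ associatedPrimes (AdicCompletion (maximalIdeal R) R)
        (AdicCompletion (maximalIdeal R) N),
      ∃ q : Ideal (AdicCompletion (maximalIdeal R) R), q.IsPrime ∧
        Module.annihilator (AdicCompletion (maximalIdeal R) R)
          (AdicCompletion (maximalIdeal R) N) ≤ q ∧
        z ≤ q ∧ q.comap (algebraMap R (AdicCompletion (maximalIdeal R) R)) = p := by
  intro z hz
  obtain ⟨hzp, x, hx⟩ := hz
  by_contra! hcon
  obtain ⟨u, hup, hu⟩ := aux_pow p hp hdim z x hx hcon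
  apply hzp.ne_top
  rw [hx, Ideal.radical_eq_top, Ideal.eq_top_iff_one, Submodule.mem_colon_singleton, one_smul,
    Submodule.mem_bot]
  apply AdicCompletion.ext
  intro n
  obtain ⟨m, hmn⟩ := heq n
  set s := u ^ m with hs
  have hsp : s ∉ p := fun h => hup (hp.mem_of_pow_mem _ h)
  obtain ⟨c, hc⟩ := aux_AR (maximalIdeal R) (p ^ m • (⊤ : Submodule R N)) s
  have hxp := hu m
  obtain ⟨y, hy⟩ := Submodule.mkQ_surjective _ (AdicCompletion.eval (maximalIdeal R) N (n + c) x)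
  have hsy : s • y ∈ p ^ m • (⊤ : Submodule R N) ⊔ maximalIdeal R ^ (n + c) • ⊤ := by
    have h := Submodule.mem_map_of_mem (f := AdicCompletion.eval (maximalIdeal R) N (n + c)) hxp
    rw [Submodule.map_smul'', map_smul, ← hy, Submodule.map_top, AdicCompletion.range_eval,
      ← Submodule.range_mkQ, LinearMap.range_eq_map, ← Submodule.map_smul'', ← map_smul] at h
    have h' := Submodule.mem_comap.mpr h
    rwa [Submodule.comap_map_eq, Submodule.ker_mkQ] at h'
  obtain ⟨w, hw, hyw⟩ := hc (n + c) (by omega) y hsy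
  have h1 := hmn (aux_symb p hp hpsupp m _ s hsp hyw)
  have h2 : y - w ∈ (maximalIdeal R ^ n • ⊤ : Submodule R N) :=
    Submodule.smul_mono_left (Ideal.pow_right_mono (IsLocalRing.le_maximalIdeal hp.ne_top) n) h1
  rw [Nat.add_sub_cancel] at hw
  have h3 : y ∈ (maximalIdeal R ^ n • ⊤ : Submodule R N) := by
    simpa using add_mem h2 hw
  have h4 := AdicCompletion.transitionMap_comp_eval_apply (I := maximalIdeal R) (M := N)
    (Nat.le_add_right n c) x
  change AdicCompletion.transitionMap _ _ _ (AdicCompletion.eval (maximalIdeal R) N (n + c) x) = _ at h4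
  rw [← hy] at h4
  change x.val n = 0
  change _ = x.val n at h4
  rw [← h4]
  exact (Submodule.Quotient.mk_eq_zero _).mpr h3
end

section
/- Let (R, m) be a Noetherian local ring, N a finitely generated R-module, and p ∈ Supp(N) with dim R/p = 1. If for every z ∈ Ass_{R*}(N*) there exists q ∈ Supp(N*) with z ⊆ q and q ∩ R = p, then the p-symbolic topology on N is equivalent to the p-adic topology on N. -/
open Ideal

open IsLocalRing


theorem aux_noeth_complete (R S : Type*) [CommRing R] [IsNoetherianRing R] [CommRing S] [Algebra R S]
    (I : Ideal R) [IsAdicComplete (I.map (algebraMap R S)) S]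
    (hsurj : Function.Surjective ((Ideal.Quotient.mk (I.map (algebraMap R S))).comp (algebraMap R S))) :
    IsNoetherianRing S := by
  classical
  obtain ⟨T, hT⟩ := (IsNoetherian.noetherian I : I.FG)
  let J := I.map (algebraMap R S)
  let : UniformSpace R := ⊥
  have : DiscreteUniformity R := ⟨rfl⟩
  have : DiscreteTopology R := inferInstance
  have : IsTopologicalRing R := inferInstance
  have : IsUniformAddGroup R := inferInstance
  let : WithIdeal S := ⟨J⟩
  have hadic : IsAdic J := rfl
  have hct := hadic.isAdicComplete_iff.mp ‹_›
  have := hct.1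
  have := hct.2
  have : IsLinearTopology S S := inferInstance
  let a : T → S := fun t => algebraMap R S t
  have haJ : ∀ t, a t ∈ J := fun t => Ideal.mem_map_of_mem _ (hT ▸ Ideal.subset_span t.2)
  have ha : MvPowerSeries.HasEval a := 
    { hpow := fun t => by
        rw [IsTopologicallyNilpotent, hadic.hasBasis_nhds_zero.tendsto_right_iff]
        intro i _
        filter_upwards [Filter.eventually_ge_atTop i] with n hn
        exact Ideal.pow_le_pow_right hn (Ideal.pow_mem_pow (haJ t) n)
      tendsto_zero := by simp [Filter.cofinite_eq_bot] }
  have hφ : Continuous (algebraMap R S) := continuous_of_discreteTopology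
  let f := MvPowerSeries.eval₂Hom hφ ha
  have hfC : ∀ r, f (MvPowerSeries.C r) = algebraMap R S r := fun r => by
    simp [f, MvPowerSeries.coe_eval₂Hom]
  have hfX : ∀ t, f (MvPowerSeries.X t) = a t := fun r => by
    simp [f, MvPowerSeries.coe_eval₂Hom]
  have hmap : (Ideal.span (Set.range MvPowerSeries.X) : Ideal (MvPowerSeries T R)).map f = J := by
    rw [Ideal.map_span, ← Set.range_comp]
    have : (⇑f ∘ MvPowerSeries.X) = a := funext hfX
    rw [this]
    change _ = I.map _
    rw [← hT, Ideal.map_span]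
    congr 1
    ext x
    simp [a]
  have hs : Function.Surjective f := by
    have : IsHausdorff ((Ideal.span (Set.range MvPowerSeries.X) : Ideal (MvPowerSeries T R)).map f) S := by
      rw [hmap]; infer_instance
    apply surjective_of_mk_map_comp_surjective (I := (Ideal.span (Set.range MvPowerSeries.X) : Ideal (MvPowerSeries T R)))
    rw [hmap]
    intro y
    obtain ⟨r, hr⟩ := hsurj y
    exact ⟨MvPowerSeries.C r, by rw [← hr]; simp only [RingHom.comp_apply, hfC]; rfl⟩
  exact isNoetherianRing_of_surjective _ _ f hs

theorem aux_noeth (R : Type*) [CommRing R] [IsNoetherianRing R] [IsLocalRing R] :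
    IsNoetherianRing (AdicCompletion (maximalIdeal R) R) := by
  have hfg := (maximalIdeal R).fg_of_isNoetherianRing
  have := AdicCompletion.isAdicComplete_self (maximalIdeal R) hfg
  refine aux_noeth_complete R _ (maximalIdeal R) ?_
  intro y
  obtain ⟨y, rfl⟩ := Ideal.Quotient.mk_surjective y
  obtain ⟨r, hr⟩ := Submodule.mkQ_surjective _ (AdicCompletion.eval (maximalIdeal R) R 1 y)
  refine ⟨r, ?_⟩
  rw [RingHom.comp_apply, Ideal.Quotient.eq, ← AdicCompletion.maximalIdeal_eq_map, AdicCompletion.mem_maximalIdeal_iff_eval_one_eq_zero]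
  rw [← AdicCompletion.eval_apply, map_sub, ← hr, sub_eq_zero]
  rfl


theorem aux_krull {S M : Type*} [CommRing S] [IsNoetherianRing S] [AddCommGroup M] [Module S M]
    [Module.Finite S M] (J q : Ideal S) (hq : q.IsPrime) (hJ : J ≤ q) (x : M)
    (hx : ∀ k : ℕ, ∃ s, s ∉ q ∧ s • x ∈ (J ^ k • ⊤ : Submodule S M)) :
    ∃ t, t ∉ q ∧ t • x = 0 := by
  let A := Localization.AtPrime q
  let f := LocalizedModule.mkLinearMap q.primeCompl M
  have hJm : J.map (algebraMap S A) ≠ ⊤ := by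
    intro h
    have h2 : J.map (algebraMap S A) ≤ maximalIdeal A := by
      rw [← Localization.AtPrime.map_eq_maximalIdeal]
      exact Ideal.map_mono hJ
    rw [h, top_le_iff] at h2
    exact (maximalIdeal.isMaximal A).ne_top h2
  have key : f x ∈ (⨅ i : ℕ, (J.map (algebraMap S A)) ^ i • ⊤ : Submodule A (LocalizedModule q.primeCompl M)) := by
    rw [Submodule.mem_iInf]
    intro k
    obtain ⟨s, hs, hsx⟩ := hx k
    have h1 : ∀ y ∈ (J ^ k • ⊤ : Submodule S M), f y ∈ ((J.map (algebraMap S A)) ^ k • ⊤ : Submodule A (LocalizedModule q.primeCompl M)) := by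
      intro y hy
      refine Submodule.smul_induction_on hy ?_ ?_
      · intro r hr n _
        rw [map_smul, ← algebraMap_smul A r, ← Ideal.map_pow]
        exact Submodule.smul_mem_smul (Ideal.mem_map_of_mem _ hr) trivial
      · intro a b ha hb
        rw [map_add]; exact add_mem ha hb
    have h2 := h1 _ hsx
    rw [map_smul, ← algebraMap_smul A s] at h2
    have hu : IsUnit (algebraMap S A s) := IsLocalization.map_units A (⟨s, hs⟩ : q.primeCompl)
    exact (Submodule.smul_mem_iff_of_isUnit _ hu).mp h2
  rw [Ideal.iInf_pow_smul_eq_bot_of_isLocalRing _ hJm, Submodule.mem_bot] at key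
  obtain ⟨c, hc⟩ := (IsLocalizedModule.eq_zero_iff q.primeCompl f).mp key
  exact ⟨c, c.2, hc⟩

theorem aux_fin (R : Type*) [CommRing R] (I : Ideal R) (N : Type*) [AddCommGroup N] [Module R N] [Module.Finite R N] :
    Module.Finite (AdicCompletion I R) (AdicCompletion I N) :=
  Module.Finite.of_surjective _ (AdicCompletion.ofTensorProduct_surjective_of_finite I N)

theorem aux_lift {R : Type*} [CommRing R] [IsNoetherianRing R] (I : Ideal R) {N : Type*} [AddCommGroup N] [Module R N] [Module.Finite R N] (U : Submodule R N) (y : AdicCompletion I N)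
    (hy : ∀ j, y.val j ∈ U.map (Submodule.mkQ (I ^ j • ⊤ : Submodule R N))) :
    ∃ u : AdicCompletion I U, AdicCompletion.map I U.subtype u = y := by
  choose u huU hu using hy
  obtain ⟨c, hc⟩ := Ideal.exists_pow_inf_eq_pow_smul I U
  have hstep : ∀ j, u j - u (j+1) ∈ (I ^ j • ⊤ : Submodule R N) := by
    intro j
    rw [← Submodule.Quotient.mk_eq_zero, Submodule.Quotient.mk_sub, sub_eq_zero]
    have h1 := hu j
    have h2 := congrArg (AdicCompletion.transitionMap I N (Nat.le_succ j)) (hu (j+1))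
    rw [y.2 (Nat.le_succ j)] at h2
    exact h1.trans h2.symm
  let v : ℕ → U := fun j => ⟨u (j + c), huU _⟩
  have hv : ∀ n, v n ≡ v (n+1) [SMOD (I ^ n • ⊤ : Submodule R U)] := by
    intro n
    rw [SModEq.sub_mem]
    have h1 : u (n + c) - u (n + 1 + c) ∈ (I ^ (n+c) • ⊤ ⊓ U : Submodule R N) := by
      refine ⟨?_, U.sub_mem (huU _) (huU _)⟩
      have := hstep (n + c)
      rwa [show n + c + 1 = n + 1 + c by ring] at this
    rw [hc _ (by omega), Nat.add_sub_cancel] at h1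
    have h2 : u (n + c) - u (n + 1 + c) ∈ (I ^ n • ⊤ : Submodule R U).map U.subtype := by
      rw [Submodule.map_smul'', Submodule.map_top, Submodule.range_subtype]
      exact Submodule.smul_mono le_rfl inf_le_right h1
    obtain ⟨w, hw, hw2⟩ := h2
    have : w = v n - v (n+1) := Subtype.ext hw2
    exact this ▸ hw
  refine ⟨AdicCompletion.mk I U (AdicCompletion.AdicCauchySequence.mk I U v hv), ?_⟩
  ext n
  have h3 := congrArg (AdicCompletion.transitionMap I N (Nat.le_add_right n c)) (hu (n+c))
  rw [y.2 (Nat.le_add_right n c)] at h3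
  rw [← h3]
  rfl

theorem aux_closed {R : Type*} [CommRing R] [IsNoetherianRing R] (I p : Ideal R) {N : Type*} [AddCommGroup N] [Module R N] [Module.Finite R N] (k : ℕ) (y : AdicCompletion I N)
    (hy : ∀ j, y.val j ∈ (p ^ k • ⊤ : Submodule R N).map (Submodule.mkQ (I ^ j • ⊤ : Submodule R N))) :
    y ∈ ((p.map (algebraMap R (AdicCompletion I R))) ^ k • ⊤ : Submodule (AdicCompletion I R) (AdicCompletion I N)) := by
  set U := (p ^ k • ⊤ : Submodule R N) with hU
  obtain ⟨u, rfl⟩ := aux_lift I U y hy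
  clear hy
  obtain ⟨w, rfl⟩ := AdicCompletion.ofTensorProduct_surjective_of_finite I U u
  induction w using TensorProduct.induction_on with
  | zero => simp
  | add a b ha hb => rw [map_add, map_add]; exact add_mem ha hb
  | tmul r v => 
    rw [AdicCompletion.ofTensorProduct_tmul, map_smul, AdicCompletion.map_of]
    apply Submodule.smul_mem
    obtain ⟨v, hv⟩ := v
    change AdicCompletion.of I N v ∈ _
    refine Submodule.smul_induction_on hv ?_ ?_
    · intro r hr n _
      rw [map_smul, ← algebraMap_smul (AdicCompletion I R) r, ← Ideal.map_pow]
      exact Submodule.smul_mem_smul (Ideal.mem_map_of_mem _ hr) trivial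
    · intro a b ha hb
      rw [map_add]; exact add_mem ha hb

theorem aux_artinian (R : Type*) [CommRing R] [IsNoetherianRing R] [IsLocalRing R]
    (N : Type*) [AddCommGroup N] [Module R N] [Module.Finite R N] (j : ℕ) :
    IsArtinian R (N ⧸ (maximalIdeal R ^ j • ⊤ : Submodule R N)) := by
  have h1 : IsArtinianRing (R ⧸ maximalIdeal R ^ j) := by
    rcases Nat.eq_zero_or_pos j with rfl | hj
    · have : Subsingleton (R ⧸ maximalIdeal R ^ 0) := by
        rw [pow_zero, Ideal.one_eq_top]; exact Ideal.Quotient.subsingleton_iff.mpr rfl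
      infer_instance
    · apply quotient_artinian_of_mem_minimalPrimes_of_isLocalRing
      refine ⟨⟨inferInstance, Ideal.pow_le_self hj.ne'⟩, fun q hq _ => hq.1.le_of_pow_le hq.2⟩
  have h2 : IsArtinian (R ⧸ maximalIdeal R ^ j) (N ⧸ (maximalIdeal R ^ j • ⊤ : Submodule R N)) := by
    have : Module.Finite (R ⧸ maximalIdeal R ^ j) (N ⧸ (maximalIdeal R ^ j • ⊤ : Submodule R N)) := 
      Module.Finite.of_restrictScalars_finite R _ _
    infer_instance
  exact isArtinian_of_surjective_algebraMap (S := R) (R := R ⧸ maximalIdeal R ^ j) Ideal.Quotient.mk_surjective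

theorem aux_chevalley {R : Type*} [CommRing R] [IsNoetherianRing R] [IsLocalRing R]
    {N : Type*} [AddCommGroup N] [Module R N] [Module.Finite R N] (S : ℕ → Submodule R N)
    (hS : Antitone S) (j₀ : ℕ) (h : ∀ k, ¬ S k ≤ (maximalIdeal R ^ j₀ • ⊤ : Submodule R N)) :
    ∃ x : AdicCompletion (maximalIdeal R) N, x ≠ 0 ∧
      ∀ k j, x.val j ∈ (S k).map (Submodule.mkQ (maximalIdeal R ^ j • ⊤ : Submodule R N)) := by
  have hst : ∀ j, ∃ K, ∀ k, S K ≤ S k ⊔ (maximalIdeal R ^ j • ⊤ : Submodule R N) := by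
    intro j
    have := aux_artinian R N j
    let f : ℕ →o (Submodule R (N ⧸ (maximalIdeal R ^ j • ⊤ : Submodule R N)))ᵒᵈ :=
      ⟨fun k => OrderDual.toDual ((S k).map (Submodule.mkQ _)), fun a b hab => 
        OrderDual.toDual_le_toDual.mpr (Submodule.map_mono (hS hab))⟩
    obtain ⟨K, hK⟩ := IsArtinian.monotone_stabilizes f
    refine ⟨K, fun k => ?_⟩
    rcases le_total K k with hk | hk
    · have h1 : (S K).map (Submodule.mkQ (maximalIdeal R ^ j • ⊤ : Submodule R N)) = (S k).map (Submodule.mkQ _) := hK k hk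
      have h2 := Submodule.le_comap_map (Submodule.mkQ (maximalIdeal R ^ j • ⊤ : Submodule R N)) (S K)
      rw [h1, Submodule.comap_map_mkQ, sup_comm] at h2
      exact h2
    · exact (hS hk).trans le_sup_left
  choose K hK using hst
  have hnext : ∀ n, ∀ u : S (K (j₀ + n)), ∃ w : S (K (j₀ + (n+1))),
      (u : N) - w ∈ (maximalIdeal R ^ (j₀ + n) • ⊤ : Submodule R N) := by
    intro n u
    obtain ⟨a, ha, b, hb, hab⟩ := Submodule.mem_sup.mp (hK (j₀ + n) (K (j₀ + (n+1))) u.2)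
    exact ⟨⟨a, ha⟩, by rw [← hab]; simpa using hb⟩
  choose nx hnx using hnext
  obtain ⟨u0, hu0, hu0'⟩ := Set.not_subset.mp (h (K (j₀ + 0)))
  let u : ∀ n, S (K (j₀ + n)) := fun n => Nat.rec ⟨u0, hu0⟩ (fun n w => nx n w) n
  have hu : ∀ n, (u n).1 - (u (n+1)).1 ∈ (maximalIdeal R ^ (j₀ + n) • ⊤ : Submodule R N) := fun n => hnx n (u n)
  have hmono : ∀ {a b : ℕ}, a ≤ b → (maximalIdeal R ^ b • ⊤ : Submodule R N) ≤ maximalIdeal R ^ a • ⊤ :=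
    fun hab => Submodule.smul_mono_left (Ideal.pow_le_pow_right hab)
  have hd : ∀ n, (u0 - (u n).1 : N) ∈ (maximalIdeal R ^ j₀ • ⊤ : Submodule R N) := by
    intro n
    induction n with
    | zero => simp [u]
    | succ n ih => 
      have := add_mem ih (hmono (Nat.le_add_right j₀ n) (hu n))
      rwa [sub_add_sub_cancel] at this
  refine ⟨AdicCompletion.mk _ N (AdicCompletion.AdicCauchySequence.mk _ N (fun n => (u n).1) 
    fun n => SModEq.sub_mem.mpr (hmono (Nat.le_add_left n j₀) (hu n))), ?_, ?_⟩
  · intro h0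
    have h1 := congrArg (fun x => x.val j₀) h0
    have h2 : Submodule.mkQ (maximalIdeal R ^ j₀ • ⊤ : Submodule R N) (u j₀).1 = 0 := h1
    rw [Submodule.mkQ_apply, Submodule.Quotient.mk_eq_zero] at h2
    apply hu0'
    have := add_mem (hd j₀) h2
    simpa using this
  · intro k j
    obtain ⟨a, ha, b, hb, hab⟩ := Submodule.mem_sup.mp (hK (j₀ + j) k (u j).2)
    refine ⟨a, ha, ?_⟩
    change _ = Submodule.mkQ _ (u j).1
    rw [← hab, map_add, left_eq_add, Submodule.mkQ_apply, Submodule.Quotient.mk_eq_zero]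
    exact hmono (Nat.le_add_left j j₀) hb

theorem aux_mAss {R : Type*} [CommRing R] [IsNoetherianRing R]
    {N : Type*} [AddCommGroup N] [Module R N] [Module.Finite R N]
    (p : Ideal R) (hp : p.IsPrime) (hpsupp : Module.annihilator R N ≤ p) :
    p ∈ mAss R (N ⧸ (p • ⊤ : Submodule R N)) := by
  have h1 : p ≤ Module.annihilator R (N ⧸ (p • ⊤ : Submodule R N)) := by
    intro r hr
    rw [Module.mem_annihilator]
    intro y
    obtain ⟨y, rfl⟩ := Submodule.mkQ_surjective _ y
    rw [← map_smul, Submodule.mkQ_apply, Submodule.Quotient.mk_eq_zero]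
    exact Submodule.smul_mem_smul hr trivial
  have h2 : Module.annihilator R (N ⧸ (p • ⊤ : Submodule R N)) ≤ p := by
    have : (⟨p, hp⟩ : PrimeSpectrum R) ∈ Module.support R (N ⧸ (p • ⊤ : Submodule R N)) := by
      rw [Module.support_quotient, Module.support_eq_zeroLocus]
      exact ⟨hpsupp, le_refl p⟩
    rw [Module.support_eq_zeroLocus] at this
    exact this
  refine ⟨?_, fun q hq _ => ?_⟩
  · apply Module.associatedPrimes.minimalPrimes_annihilator_subset_associatedPrimes
    exact ⟨⟨hp, h2⟩, fun q hq _ => h1.trans hq.2⟩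
  · exact h1.trans (Submodule.annihilator_top.ge.trans (IsAssociatedPrime.annihilator_le hq))

/-- Elements of `N` moved into `p ^ k N` by something outside `p`. -/
def auxS {R : Type*} [CommRing R] {N : Type*} [AddCommGroup N] [Module R N]
    (p : Ideal R) (hp : p.IsPrime) (k : ℕ) : Submodule R N where
  carrier := {x | ∃ s, s ∉ p ∧ s • x ∈ (p ^ k • ⊤ : Submodule R N)}
  zero_mem' := ⟨1, hp.one_notMem, by simp⟩
  add_mem' := by
    rintro a b ⟨s, hs, ha⟩ ⟨t, ht, hb⟩
    refine ⟨s * t, fun h => (hp.mem_or_mem h).elim hs ht, ?_⟩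
    rw [smul_add]
    refine add_mem ?_ ?_
    · rw [mul_comm, mul_smul]; exact Submodule.smul_mem _ _ ha
    · rw [mul_smul]; exact Submodule.smul_mem _ _ hb
  smul_mem' := by
    rintro c a ⟨s, hs, ha⟩
    exact ⟨s, hs, by rw [smul_comm]; exact Submodule.smul_mem _ _ ha⟩

theorem auxS_anti {R : Type*} [CommRing R] {N : Type*} [AddCommGroup N] [Module R N]
    (p : Ideal R) (hp : p.IsPrime) : Antitone (auxS (N := N) p hp) := by
  rintro a b hab x ⟨s, hs, hx⟩
  exact ⟨s, hs, Submodule.smul_mono_left (Ideal.pow_le_pow_right hab) hx⟩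

theorem auxS_common {R : Type*} [CommRing R] {N : Type*} [AddCommGroup N] [Module R N]
    (p : Ideal R) (hp : p.IsPrime) (k : ℕ) (T : Submodule R N) (hT : T.FG)
    (hTS : T ≤ auxS p hp k) : ∃ s, s ∉ p ∧ ∀ x ∈ T, s • x ∈ (p ^ k • ⊤ : Submodule R N) := by
  induction T, hT using Submodule.fg_induction with
  | singleton x =>
    obtain ⟨s, hs, hx⟩ := hTS (Submodule.mem_span_singleton_self x)
    refine ⟨s, hs, fun y hy => ?_⟩
    obtain ⟨c, rfl⟩ := Submodule.mem_span_singleton.mp hy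
    rw [smul_comm]; exact Submodule.smul_mem _ _ hx
  | sup A B _ _ hA hB =>
    obtain ⟨s, hs, ha⟩ := hA (le_sup_left.trans hTS)
    obtain ⟨t, ht, hb⟩ := hB (le_sup_right.trans hTS)
    refine ⟨s * t, fun h => (hp.mem_or_mem h).elim hs ht, fun y hy => ?_⟩
    obtain ⟨a, haA, b, hbB, rfl⟩ := Submodule.mem_sup.mp hy
    rw [smul_add]
    refine add_mem ?_ ?_
    · rw [mul_comm, mul_smul]; exact Submodule.smul_mem _ _ (ha a haA)
    · rw [mul_smul]; exact Submodule.smul_mem _ _ (hb b hbB)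

theorem aux_prime_max {R : Type*} [CommRing R] 
    (p : Ideal R) (hp : p.IsPrime) (hdim : ringKrullDim (R ⧸ p) = 1)
    (P : Ideal R) (hP : P.IsPrime) (hle : p ≤ P) (s : R) (hs : s ∈ P) (hsp : s ∉ p) : P.IsMaximal := by
  have : Ring.KrullDimLE 1 (R ⧸ p) := Ring.krullDimLE_iff.mpr (by rw [hdim]; rfl)
  have hker : RingHom.ker (Ideal.Quotient.mk p) ≤ P := by rwa [Ideal.mk_ker]
  have h1 : (P.map (Ideal.Quotient.mk p)).IsPrime := 
    Ideal.map_isPrime_of_surjective Ideal.Quotient.mk_surjective hker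
  have h2 : P.map (Ideal.Quotient.mk p) ≠ ⊥ := by
    intro h
    have := Ideal.mem_map_of_mem (Ideal.Quotient.mk p) hs
    rw [h, Ideal.mem_bot, Ideal.Quotient.eq_zero_iff_mem] at this
    exact hsp this
  have h3 := h1.isMaximal_of_ne_bot h2
  have h4 := Ideal.comap_isMaximal_of_surjective (Ideal.Quotient.mk p) Ideal.Quotient.mk_surjective (K := P.map (Ideal.Quotient.mk p))
  rwa [Ideal.comap_map_of_surjective' _ Ideal.Quotient.mk_surjective, sup_eq_left.mpr hker] at h4

theorem aux_ne_max {R : Type*} [CommRing R] [IsLocalRing R]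
    (p : Ideal R) (hdim : ringKrullDim (R ⧸ p) = 1) : ¬ maximalIdeal R ≤ p := by
  intro h
  rcases eq_or_ne p ⊤ with rfl | hne
  · have : Subsingleton (R ⧸ (⊤ : Ideal R)) := Ideal.Quotient.subsingleton_iff.mpr rfl
    rw [ringKrullDim_eq_bot_of_subsingleton] at hdim
    exact absurd hdim (by decide)
  · have : p.IsMaximal := by
      rw [← (maximalIdeal.isMaximal R).eq_of_le hne h]; infer_instance
    have := Ideal.Quotient.maximal_ideal_iff_isField_quotient p |>.mp this
    rw [ringKrullDim_eq_zero_of_isField this] at hdim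
    exact absurd hdim (by decide)

theorem aux_kill {R : Type*} [CommRing R] [IsNoetherianRing R] [IsLocalRing R]
    {N : Type*} [AddCommGroup N] [Module R N] [Module.Finite R N]
    (p : Ideal R) (hp : p.IsPrime) (hdim : ringKrullDim (R ⧸ p) = 1) (k : ℕ) :
    ∃ c, (maximalIdeal R ^ c • auxS p hp k : Submodule R N) ≤ p ^ k • ⊤ := by
  obtain ⟨s, hs, hx⟩ := auxS_common (N := N) p hp k _ (IsNoetherian.noetherian (auxS p hp k)) le_rfl
  have hrad : maximalIdeal R ≤ (Ideal.span {s} ⊔ p ^ k).radical := by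
    rw [Ideal.radical_eq_sInf]
    refine le_sInf ?_
    rintro P ⟨hP, hPp⟩
    have h1 : s ∈ P := hP (Ideal.mem_sup_left (Ideal.mem_span_singleton_self s))
    have h2 : p ≤ P := hPp.le_of_pow_le (le_sup_right.trans hP)
    exact (IsLocalRing.eq_maximalIdeal (aux_prime_max p hp hdim P hPp h2 s h1 hs)).ge
  obtain ⟨c, hc⟩ := Ideal.exists_pow_le_of_le_radical_of_fg hrad (IsNoetherian.noetherian _)
  refine ⟨c, (Submodule.smul_mono_left hc).trans ?_⟩
  rw [Submodule.sup_smul]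
  refine sup_le ?_ (Submodule.smul_mono le_rfl le_top)
  rw [Submodule.smul_le]
  intro r hr n hn
  obtain ⟨a, rfl⟩ := Ideal.mem_span_singleton'.mp hr
  rw [mul_smul]
  exact Submodule.smul_mem _ _ (hx n hn)

open IsLocalRing in
theorem stmt9 (R : Type*) [CommRing R] [IsNoetherianRing R] [IsLocalRing R]
    (N : Type*) [AddCommGroup N] [Module R N] [Module.Finite R N] [Nontrivial N]
    (p : Ideal R) (hp : p.IsPrime) (hpsupp : Module.annihilator R N ≤ p)
    (hdim : ringKrullDim (R ⧸ p) = 1)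
    (h : ∀ z ∈ associatedPrimes (AdicCompletion (maximalIdeal R) R)
        (AdicCompletion (maximalIdeal R) N),
      ∃ q : Ideal (AdicCompletion (maximalIdeal R) R), q.IsPrime ∧
        Module.annihilator (AdicCompletion (maximalIdeal R) R)
          (AdicCompletion (maximalIdeal R) N) ≤ q ∧
        z ≤ q ∧ q.comap (algebraMap R (AdicCompletion (maximalIdeal R) R)) = p) :
    symbEquivAdic R p N := by
  intro n
  have hnoeth := aux_noeth R
  have hfin := aux_fin R (maximalIdeal R) N
  obtain ⟨c, hc⟩ := aux_kill (N := N) p hp hdim n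
  obtain ⟨k₀, hk₀⟩ := Ideal.exists_pow_inf_eq_pow_smul (maximalIdeal R) (auxS (N := N) p hp n)
  have key : ∃ k, auxS (N := N) p hp k ≤ maximalIdeal R ^ (c + k₀) • ⊤ := by
    by_contra hcon
    push Not at hcon
    obtain ⟨x, hx0, hx⟩ := aux_chevalley _ (auxS_anti p hp) _ hcon
    obtain ⟨z, hz, hxz⟩ := exists_le_isAssociatedPrime_of_isNoetherianRing
      (AdicCompletion (maximalIdeal R) R) x hx0
    obtain ⟨q, hq, -, hzq, hqp⟩ := h z hz
    obtain ⟨t, htq, htx⟩ := aux_krull (p.map (algebraMap R (AdicCompletion (maximalIdeal R) R))) q hq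
      (Ideal.map_le_iff_le_comap.mpr hqp.ge) x (fun k => by
        obtain ⟨c', hc'⟩ := aux_kill (N := N) p hp hdim k
        obtain ⟨s, hs, hsp⟩ := Set.not_subset.mp 
          (fun hh : maximalIdeal R ^ c' ≤ p => aux_ne_max p hdim (hp.le_of_pow_le hh))
        refine ⟨algebraMap R _ s, fun hsq => hsp ?_, ?_⟩
        · rw [← hqp]; exact hsq
        · rw [algebraMap_smul]
          apply aux_closed
          intro j
          obtain ⟨u, hu, huj⟩ := hx k j
          refine ⟨s • u, hc' (Submodule.smul_mem_smul hs hu), ?_⟩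
          rw [map_smul, huj]
          rfl)
    exact htq (hzq (hxz (by simpa [Submodule.mem_colon_singleton] using htx)))
  obtain ⟨k, hk⟩ := key
  refine ⟨max k n, ?_⟩
  rintro y ⟨s, hs, hy⟩
  have hyS : y ∈ auxS (N := N) p hp (max k n) := ⟨s, hs p (aux_mAss p hp hpsupp), hy⟩
  have h1 := hk (auxS_anti p hp (le_max_left k n) hyS)
  have h2 := auxS_anti p hp (le_max_right k n) hyS
  have h3 : y ∈ (maximalIdeal R ^ (c + k₀) • ⊤ ⊓ auxS p hp n : Submodule R N) := ⟨h1, h2⟩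
  rw [hk₀ _ (by omega), Nat.add_sub_cancel] at h3
  exact hc (Submodule.smul_mono le_rfl inf_le_right h3)
end
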